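/- Fix nonempty finite sets Ω and A, a finite message set M with |M| > max{|Ω|, |A|}, and an interior prior μ₀ on Ω. If an environment (u_S, u_R) satisfies scant-indifferences and commitment has no value, then there exist a partitional messaging strategy σ̂ and a pure action strategy ρ̂ such that (σ̂, ρ̂) is a cheap-talk equilibrium, U_S(σ̂, ρ̂) equals the persuasion payoff, and at most |A| messages are sent with positive probability under σ̂. -/

import Mathlib

open MeasureTheory

namespace KL

/-- `f` is a probability distribution on the finite type `X`. -/
def IsDist {X : Type} [Fintype X] (f : X → ℝ) : Prop :=
  (∀ x, 0 ≤ f x) ∧ ∑ x, f x = 1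

/-- `μ₀` is an interior prior on `Ω`. -/
def IsPrior {Ω : Type} [Fintype Ω] (μ₀ : Ω → ℝ) : Prop :=
  (∀ ω, 0 < μ₀ ω) ∧ ∑ ω, μ₀ ω = 1

variable {Ω A M : Type} [Fintype Ω] [Fintype A] [Fintype M]

/-- A messaging strategy: a distribution over messages in each state. -/
def IsMsg (σ : Ω → M → ℝ) : Prop := ∀ ω, IsDist (σ ω)

/-- An action strategy: a distribution over actions after each message. -/
def IsAct (ρ : M → A → ℝ) : Prop := ∀ m, IsDist (ρ m)

/-- Expected payoff of a profile `(σ, ρ)` for utility `u`. -/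
def U (μ₀ : Ω → ℝ) (u : A × Ω → ℝ) (σ : Ω → M → ℝ) (ρ : M → A → ℝ) : ℝ :=
  ∑ ω, ∑ m, ∑ a, μ₀ ω * σ ω m * ρ m a * u (a, ω)

/-- Sender best response. -/
def SBR (μ₀ : Ω → ℝ) (uS : A × Ω → ℝ) (σ : Ω → M → ℝ) (ρ : M → A → ℝ) : Prop :=
  ∀ σ' : Ω → M → ℝ, IsMsg σ' → U μ₀ uS σ' ρ ≤ U μ₀ uS σ ρ

/-- Receiver best response. -/
def RBR (μ₀ : Ω → ℝ) (uR : A × Ω → ℝ) (σ : Ω → M → ℝ) (ρ : M → A → ℝ) : Prop :=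
  ∀ ρ' : M → A → ℝ, IsAct ρ' → U μ₀ uR σ ρ' ≤ U μ₀ uR σ ρ

/-- A cheap-talk equilibrium: a profile of valid strategies that is S-BR and R-BR. -/
def CTEq (μ₀ : Ω → ℝ) (uS uR : A × Ω → ℝ) (σ : Ω → M → ℝ) (ρ : M → A → ℝ) : Prop :=
  IsMsg σ ∧ IsAct ρ ∧ SBR μ₀ uS σ ρ ∧ RBR μ₀ uR σ ρ

/-- A persuasion profile: a profile of valid strategies that is R-BR. -/
def PersProfile (μ₀ : Ω → ℝ) (uR : A × Ω → ℝ) (σ : Ω → M → ℝ) (ρ : M → A → ℝ) : Prop :=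
  IsMsg σ ∧ IsAct ρ ∧ RBR μ₀ uR σ ρ

/-- The cheap-talk payoff: the maximal Sender payoff over cheap-talk equilibria. -/
noncomputable def ctPayoff (μ₀ : Ω → ℝ) (uS uR : A × Ω → ℝ) : ℝ :=
  sSup {x | ∃ (σ : Ω → M → ℝ) (ρ : M → A → ℝ), CTEq μ₀ uS uR σ ρ ∧ x = U μ₀ uS σ ρ}

/-- The (Bayesian) persuasion payoff: the maximal Sender payoff over persuasion profiles. -/
noncomputable def persPayoff (μ₀ : Ω → ℝ) (uS uR : A × Ω → ℝ) : ℝ :=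
  sSup {x | ∃ (σ : Ω → M → ℝ) (ρ : M → A → ℝ), PersProfile μ₀ uR σ ρ ∧ x = U μ₀ uS σ ρ}

/-- A messaging strategy is partitional if it is deterministic in every state. -/
def Partitional (σ : Ω → M → ℝ) : Prop := ∀ ω, ∃ m, σ ω m = 1

/-- The partitional persuasion payoff. -/
noncomputable def partPersPayoff (μ₀ : Ω → ℝ) (uS uR : A × Ω → ℝ) : ℝ :=
  sSup {x | ∃ (σ : Ω → M → ℝ) (ρ : M → A → ℝ),
    Partitional σ ∧ PersProfile μ₀ uR σ ρ ∧ x = U μ₀ uS σ ρ}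

/-- The partitional cheap-talk payoff. -/
noncomputable def partCtPayoff (μ₀ : Ω → ℝ) (uS uR : A × Ω → ℝ) : ℝ :=
  sSup {x | ∃ (σ : Ω → M → ℝ) (ρ : M → A → ℝ),
    Partitional σ ∧ CTEq μ₀ uS uR σ ρ ∧ x = U μ₀ uS σ ρ}

/-- A message is on-path if it is sent with positive probability in some state. -/
def OnPath (σ : Ω → M → ℝ) (m : M) : Prop := ∃ ω, 0 < σ ω m

/-- A pure action strategy: degenerate after every message. -/
def IsPureAct (ρ : M → A → ℝ) : Prop := ∀ m, ∃ a, ρ m a = 1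

/-- A pure-on-path action strategy: degenerate after every on-path message. -/
def PureOnPath (σ : Ω → M → ℝ) (ρ : M → A → ℝ) : Prop :=
  ∀ m, OnPath σ m → ∃ a, ρ m a = 1

/-- The posterior belief induced by message `m`. -/
noncomputable def post (μ₀ : Ω → ℝ) (σ : Ω → M → ℝ) (m : M) (ω : Ω) : ℝ :=
  μ₀ ω * σ ω m / ∑ ω', μ₀ ω' * σ ω' m

/-- The cube of environments `[0,1]^(2|A||Ω|)`. -/
def EnvCube (Ω A : Type) : Set ((A × Ω → ℝ) × (A × Ω → ℝ)) :=
  {e | (∀ p, e.1 p ∈ Set.Icc (0 : ℝ) 1) ∧ ∀ p, e.2 p ∈ Set.Icc (0 : ℝ) 1}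

/-- The cube of transparent environments `[0,1]^(|A|(|Ω|+1))`, points `(v, u_R)`. -/
def TransCube (Ω A : Type) : Set ((A → ℝ) × (A × Ω → ℝ)) :=
  {e | (∀ a, e.1 a ∈ Set.Icc (0 : ℝ) 1) ∧ ∀ p, e.2 p ∈ Set.Icc (0 : ℝ) 1}

open Classical in
/-- The expanded-indifference matrix `T^i`: rows `u_S(a_j,·) − u_S(a_i,·)` for `j ≠ i`,
rows `u_R(a_j,·) − u_R(a_i,·)` for `j ≠ i`, and the rows of the identity matrix. -/
noncomputable def TMat (uS uR : A × Ω → ℝ) (i : A) :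
    Matrix (({j : A // j ≠ i} ⊕ {j : A // j ≠ i}) ⊕ Ω) Ω ℝ :=
  Matrix.of fun r ω =>
    match r with
    | Sum.inl (Sum.inl j) => uS (j.1, ω) - uS (i, ω)
    | Sum.inl (Sum.inr j) => uR (j.1, ω) - uR (i, ω)
    | Sum.inr ω' => if ω' = ω then 1 else 0

/-- Scant indifferences: every row-submatrix of every expanded-indifference matrix has
full rank (rank equal to the minimum of the number of rows and the number of columns). -/
def ScantIndiff (uS uR : A × Ω → ℝ) : Prop :=
  ∀ i : A, ∀ s : Finset (({j : A // j ≠ i} ⊕ {j : A // j ≠ i}) ⊕ Ω),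
    ((TMat uS uR i).submatrix (fun r : {x // x ∈ s} => r.1) id).rank
      = min s.card (Fintype.card Ω)

open Classical in
/-- The set `Ω_a` of states in which `a` is an ideal action for Sender. -/
noncomputable def idealStates (uS : A × Ω → ℝ) (a : A) : Finset Ω :=
  Finset.univ.filter fun ω => ∀ b, uS (b, ω) ≤ uS (a, ω)

/-- Felicitous environment. -/
def Felicitous (μ₀ : Ω → ℝ) (uS uR : A × Ω → ℝ) : Prop :=
  ∀ a a' : A, 0 ≤ ∑ ω ∈ idealStates uS a, μ₀ ω * (uR (a, ω) - uR (a', ω))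

/-- Partitional-unique-response: for every nonempty subset of states, Receiver's
expected payoff has a unique maximizer. -/
def PUR (μ₀ : Ω → ℝ) (uR : A × Ω → ℝ) : Prop :=
  ∀ S : Finset Ω, S.Nonempty →
    ∃! a : A, ∀ b : A, ∑ ω ∈ S, μ₀ ω * uR (b, ω) ≤ ∑ ω ∈ S, μ₀ ω * uR (a, ω)

/-- Jointly-inclusive environment: each action is the unique ideal action of both
players in some state. -/
def JointlyInclusive (uS uR : A × Ω → ℝ) : Prop :=
  ∀ a : A, ∃ ω : Ω,
    (∀ b, b ≠ a → uS (b, ω) < uS (a, ω)) ∧ ∀ b, b ≠ a → uR (b, ω) < uR (a, ω)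

open Classical in
/-- Point mass. -/
noncomputable def dl {X : Type} (a : X) : X → ℝ := fun x => if x = a then 1 else 0

lemma isDist_dl {X : Type} [Fintype X] (a : X) : IsDist (dl a) := by
  classical
  constructor
  · intro x; unfold dl; split_ifs <;> norm_num
  · simp [dl]

lemma sum_dl {X : Type} [Fintype X] (a : X) (q : X → ℝ) : ∑ x, dl a x * q x = q a := by
  classical
  simp [dl]

lemma dl_pos {X : Type} {a x : X} (h : 0 < dl a x) : x = a := by
  by_contra hne
  simp [dl, hne] at h

lemma br_iff {I X : Type} [Fintype I] [Fintype X] (p q : I → X → ℝ)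
    (hp : ∀ i, IsDist (p i)) :
    (∀ p' : I → X → ℝ, (∀ i, IsDist (p' i)) →
      ∑ i, ∑ x, p' i x * q i x ≤ ∑ i, ∑ x, p i x * q i x) ↔
    ∀ i a b, 0 < p i a → q i b ≤ q i a := by
  classical
  constructor
  · intro h i a b ha
    by_contra hlt
    push Not at hlt
    obtain ⟨c, -, hc⟩ := Finset.exists_max_image Finset.univ (q i) ⟨a, Finset.mem_univ a⟩
    have h1 := h (Function.update p i (dl c)) (by
      intro k
      by_cases hk : k = i
      · subst hk; simpa using isDist_dl c
      · simpa [hk] using hp k)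
    rw [← Finset.add_sum_erase _ _ (Finset.mem_univ i),
      ← Finset.add_sum_erase Finset.univ (fun i => ∑ x, p i x * q i x) (Finset.mem_univ i)] at h1
    have h2 : ∑ k ∈ Finset.univ.erase i, ∑ x, Function.update p i (dl c) k x * q k x
        = ∑ k ∈ Finset.univ.erase i, ∑ x, p k x * q k x := by
      refine Finset.sum_congr rfl fun k hk => ?_
      rw [Function.update_of_ne (Finset.ne_of_mem_erase hk)]
    rw [h2] at h1
    simp only [Function.update_self, sum_dl] at h1
    have h3 : ∑ x, p i x * q i x < ∑ x, p i x * q i c := by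
      refine Finset.sum_lt_sum (fun x _ => ?_) ⟨a, Finset.mem_univ a, ?_⟩
      · exact mul_le_mul_of_nonneg_left (hc x (Finset.mem_univ x)) ((hp i).1 x)
      · exact mul_lt_mul_of_pos_left (hlt.trans_le (hc b (Finset.mem_univ b))) ha
    rw [← Finset.sum_mul, (hp i).2, one_mul] at h3
    linarith
  · intro h p' hp'
    refine Finset.sum_le_sum fun i _ => ?_
    have hex : ∃ a, 0 < p i a := by
      by_contra hne
      push Not at hne
      have := Finset.sum_nonpos (s := Finset.univ) (fun x _ => hne x)
      rw [(hp i).2] at this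
      linarith
    obtain ⟨a, ha⟩ := hex
    have h1 : ∑ x, p' i x * q i x ≤ ∑ x, p' i x * q i a :=
      Finset.sum_le_sum fun x _ => mul_le_mul_of_nonneg_left (h i a x ha) ((hp' i).1 x)
    have h2 : ∑ x, p i x * q i a ≤ ∑ x, p i x * q i x := by
      refine Finset.sum_le_sum fun x _ => ?_
      rcases ((hp i).1 x).eq_or_lt with h0 | h0
      · simp [← h0]
      · exact mul_le_mul_of_nonneg_left (h i x a h0) h0.le
    rw [← Finset.sum_mul, (hp' i).2] at h1
    rw [← Finset.sum_mul, (hp i).2] at h2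
    linarith

lemma U_eqR (μ₀ : Ω → ℝ) (u : A × Ω → ℝ) (σ : Ω → M → ℝ) (ρ : M → A → ℝ) :
    U μ₀ u σ ρ = ∑ m, ∑ a, ρ m a * ∑ ω, μ₀ ω * σ ω m * u (a, ω) := by
  unfold U
  rw [Finset.sum_comm]
  refine Finset.sum_congr rfl fun m _ => ?_
  rw [Finset.sum_comm]
  refine Finset.sum_congr rfl fun a _ => ?_
  rw [Finset.mul_sum]
  exact Finset.sum_congr rfl fun ω _ => by ring

lemma U_eqS (μ₀ : Ω → ℝ) (u : A × Ω → ℝ) (σ : Ω → M → ℝ) (ρ : M → A → ℝ) :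
    U μ₀ u σ ρ = ∑ ω, ∑ m, σ ω m * (μ₀ ω * ∑ a, ρ m a * u (a, ω)) := by
  unfold U
  refine Finset.sum_congr rfl fun ω _ => Finset.sum_congr rfl fun m _ => ?_
  rw [Finset.mul_sum, Finset.mul_sum]
  exact Finset.sum_congr rfl fun a _ => by ring

/-- Outcome. -/
def outc (μ₀ : Ω → ℝ) (σ : Ω → M → ℝ) (ρ : M → A → ℝ) (a : A) (ω : Ω) : ℝ :=
  ∑ m, μ₀ ω * σ ω m * ρ m a

/-- Value of an outcome. -/
def Val (u : A × Ω → ℝ) (x : A → Ω → ℝ) : ℝ := ∑ a, ∑ ω, x a ω * u (a, ω)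

lemma U_eqX (μ₀ : Ω → ℝ) (u : A × Ω → ℝ) (σ : Ω → M → ℝ) (ρ : M → A → ℝ) :
    U μ₀ u σ ρ = Val u (outc μ₀ σ ρ) := by
  unfold U Val outc
  rw [Finset.sum_comm' (t' := Finset.univ) (s' := fun _ => Finset.univ) (by simp)]
  conv_rhs => rw [Finset.sum_comm]
  rw [Finset.sum_comm]
  refine Finset.sum_congr rfl fun ω _ => ?_
  rw [Finset.sum_comm]
  refine Finset.sum_congr rfl fun a _ => ?_
  rw [Finset.sum_mul]

lemma RBR_iff {μ₀ : Ω → ℝ} {u : A × Ω → ℝ} {σ : Ω → M → ℝ} {ρ : M → A → ℝ} (hρ : IsAct ρ) :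
    RBR μ₀ u σ ρ ↔ ∀ m a b, 0 < ρ m a →
      ∑ ω, μ₀ ω * σ ω m * u (b, ω) ≤ ∑ ω, μ₀ ω * σ ω m * u (a, ω) := by
  unfold RBR
  simp only [U_eqR]
  exact br_iff ρ (fun m a => ∑ ω, μ₀ ω * σ ω m * u (a, ω)) hρ

lemma SBR_iff {μ₀ : Ω → ℝ} (hμ : IsPrior μ₀) {u : A × Ω → ℝ} {σ : Ω → M → ℝ} {ρ : M → A → ℝ}
    (hσ : IsMsg σ) :
    SBR μ₀ u σ ρ ↔ ∀ ω m m', 0 < σ ω m →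
      ∑ a, ρ m' a * u (a, ω) ≤ ∑ a, ρ m a * u (a, ω) := by
  unfold SBR
  simp only [U_eqS]
  refine (br_iff σ (fun ω m => μ₀ ω * ∑ a, ρ m a * u (a, ω)) hσ).trans ?_
  refine forall_congr' fun ω => forall_congr' fun m => forall_congr' fun m' => ?_
  rw [mul_le_mul_iff_right₀ (hμ.1 ω)]

/-- Feasible (obedient) outcomes. -/
def Feas (μ₀ : Ω → ℝ) (uR : A × Ω → ℝ) (x : A → Ω → ℝ) : Prop :=
  (∀ a ω, 0 ≤ x a ω) ∧ (∀ ω, ∑ a, x a ω = μ₀ ω) ∧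
    ∀ a b, 0 ≤ ∑ ω, x a ω * (uR (a, ω) - uR (b, ω))

lemma feas_outc {μ₀ : Ω → ℝ} (hμ : IsPrior μ₀) {uR : A × Ω → ℝ} {σ : Ω → M → ℝ}
    {ρ : M → A → ℝ} (h : PersProfile μ₀ uR σ ρ) : Feas μ₀ uR (outc μ₀ σ ρ) := by
  obtain ⟨hσ, hρ, hR⟩ := h
  rw [RBR_iff hρ] at hR
  refine ⟨fun a ω => ?_, fun ω => ?_, fun a b => ?_⟩
  · exact Finset.sum_nonneg fun m _ =>
      mul_nonneg (mul_nonneg (hμ.1 ω).le ((hσ ω).1 m)) ((hρ m).1 a)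
  · unfold outc
    rw [Finset.sum_comm]
    simp only [← Finset.mul_sum, (hρ _).2, mul_one, (hσ ω).2]
  · unfold outc
    simp only [Finset.sum_mul]
    rw [Finset.sum_comm]
    refine Finset.sum_nonneg fun m _ => ?_
    have h1 : ∑ ω, μ₀ ω * σ ω m * ρ m a * (uR (a, ω) - uR (b, ω)) =
        ρ m a * (∑ ω, μ₀ ω * σ ω m * uR (a, ω) - ∑ ω, μ₀ ω * σ ω m * uR (b, ω)) := by
      rw [← Finset.sum_sub_distrib, Finset.mul_sum]
      exact Finset.sum_congr rfl fun ω _ => by ring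
    rw [h1]
    rcases ((hρ m).1 a).eq_or_lt with h0 | h0
    · simp [← h0]
    · exact mul_nonneg h0.le (sub_nonneg.2 (hR m a b h0))

open Classical in
/-- Messaging strategy built from an outcome. -/
noncomputable def sig (μ₀ : Ω → ℝ) (x : A → Ω → ℝ) (ι : A → M) (ω : Ω) (m : M) : ℝ :=
  ∑ a, if ι a = m then x a ω / μ₀ ω else 0

lemma sig_ι {μ₀ : Ω → ℝ} {x : A → Ω → ℝ} {ι : A → M} (hι : Function.Injective ι)
    (ω : Ω) (a : A) : sig μ₀ x ι ω (ι a) = x a ω / μ₀ ω := by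
  classical
  unfold sig
  simp [hι.eq_iff]

lemma sig_not {μ₀ : Ω → ℝ} {x : A → Ω → ℝ} {ι : A → M}
    (ω : Ω) (m : M) (h : ∀ a, ι a ≠ m) : sig μ₀ x ι ω m = 0 := by
  classical
  unfold sig
  simp [h]

lemma realize {μ₀ : Ω → ℝ} (hμ : IsPrior μ₀) {uR : A × Ω → ℝ} {x : A → Ω → ℝ}
    (hx : Feas μ₀ uR x) {ι : A → M} (hι : Function.Injective ι) {g : M → A}
    (hg : ∀ a ω, x a ω ≠ 0 → g (ι a) = a) :
    PersProfile μ₀ uR (sig μ₀ x ι) (fun m => dl (g m)) ∧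
      outc μ₀ (sig μ₀ x ι) (fun m => dl (g m)) = x := by
  classical
  have hne : ∀ ω, μ₀ ω ≠ 0 := fun ω => (hμ.1 ω).ne'
  have hρ : IsAct (fun m => dl (g m)) := fun m => isDist_dl _
  refine ⟨⟨fun ω => ⟨fun m => ?_, ?_⟩, hρ, ?_⟩, ?_⟩
  · refine Finset.sum_nonneg fun a _ => ?_
    split_ifs
    · exact div_nonneg (hx.1 a ω) (hμ.1 ω).le
    · exact le_rfl
  · unfold sig
    rw [Finset.sum_comm]
    simp only [Finset.sum_ite_eq, Finset.mem_univ, if_true]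
    rw [← Finset.sum_div, hx.2.1, div_self (hne ω)]
  · rw [RBR_iff hρ]
    intro m a b ha
    have ha := dl_pos ha
    by_cases hm : ∃ c, ι c = m
    · obtain ⟨c, rfl⟩ := hm
      simp only [sig_ι hι, mul_div_cancel₀ _ (hne _)]
      by_cases hc : ∃ ω, x c ω ≠ 0
      · obtain ⟨ω, hω⟩ := hc
        rw [hg c ω hω] at ha
        subst ha
        have := hx.2.2 a b
        simp only [mul_sub, Finset.sum_sub_distrib] at this
        linarith
      · push Not at hc
        simp [hc]
    · push Not at hm
      simp [sig_not _ m hm]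
  · funext a ω
    unfold outc
    have h1 : ∀ m, μ₀ ω * sig μ₀ x ι ω m * dl (g m) a = if m = ι a then x a ω else 0 := by
      intro m
      by_cases hm : ∃ c, ι c = m
      · obtain ⟨c, rfl⟩ := hm
        rw [sig_ι hι, mul_div_cancel₀ _ (hne _)]
        by_cases hc : x c ω = 0
        · by_cases hca : c = a
          · subst hca; simp [hc]
          · simp [hc, hι.eq_iff, hca]
        · rw [hg c ω hc, hι.eq_iff]
          by_cases hca : c = a
          · subst hca; simp [dl]
          · simp [dl, hca, Ne.symm hca]
      · push Not at hm
        rw [sig_not _ m hm, if_neg (fun h => hm a h.symm)]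
        simp
    simp [h1]

lemma compact_dist (X : Type) [Fintype X] : IsCompact {f : X → ℝ | IsDist f} :=
  isCompact_stdSimplex ℝ X

lemma compact_profiles : IsCompact {p : (Ω → M → ℝ) × (M → A → ℝ) | IsMsg p.1 ∧ IsAct p.2} := by
  have h1 : IsCompact {σ : Ω → M → ℝ | IsMsg σ} := by
    have := isCompact_univ_pi (fun _ : Ω => compact_dist M)
    convert this using 1
    ext σ; simp [IsMsg]
  have h2 : IsCompact {ρ : M → A → ℝ | IsAct ρ} := by
    have := isCompact_univ_pi (fun _ : M => compact_dist A)
    convert this using 1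
    ext σ; simp [IsAct]
  exact h1.prod h2

lemma continuous_U (μ₀ : Ω → ℝ) (u : A × Ω → ℝ) :
    Continuous (fun p : (Ω → M → ℝ) × (M → A → ℝ) => U μ₀ u p.1 p.2) := by
  unfold U
  fun_prop

lemma closed_SBR (μ₀ : Ω → ℝ) (u : A × Ω → ℝ) :
    IsClosed {p : (Ω → M → ℝ) × (M → A → ℝ) | SBR μ₀ u p.1 p.2} := by
  have h : {p : (Ω → M → ℝ) × (M → A → ℝ) | SBR μ₀ u p.1 p.2} =
      ⋂ (σ' : Ω → M → ℝ) (_ : IsMsg σ'), {p | U μ₀ u σ' p.2 ≤ U μ₀ u p.1 p.2} := by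
    ext p
    simp only [Set.mem_iInter]
    exact Iff.rfl
  rw [h]
  refine isClosed_iInter fun σ' => isClosed_iInter fun _ => ?_
  have h2 : Continuous (fun p : (Ω → M → ℝ) × (M → A → ℝ) => U μ₀ u σ' p.2) := by
    unfold U
    fun_prop
  exact isClosed_le h2 (continuous_U μ₀ u)

lemma closed_RBR (μ₀ : Ω → ℝ) (u : A × Ω → ℝ) :
    IsClosed {p : (Ω → M → ℝ) × (M → A → ℝ) | RBR μ₀ u p.1 p.2} := by
  have h : {p : (Ω → M → ℝ) × (M → A → ℝ) | RBR μ₀ u p.1 p.2} =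
      ⋂ (ρ' : M → A → ℝ) (_ : IsAct ρ'), {p | U μ₀ u p.1 ρ' ≤ U μ₀ u p.1 p.2} := by
    ext p
    simp only [Set.mem_iInter]
    exact Iff.rfl
  rw [h]
  refine isClosed_iInter fun σ' => isClosed_iInter fun _ => ?_
  have h2 : Continuous (fun p : (Ω → M → ℝ) × (M → A → ℝ) => U μ₀ u p.1 σ') := by
    unfold U
    fun_prop
  exact isClosed_le h2 (continuous_U μ₀ u)

lemma babble (M : Type) [Fintype M] [Nonempty M] [Nonempty A] {μ₀ : Ω → ℝ}
    (hμ : IsPrior μ₀) (uS uR : A × Ω → ℝ) :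
    ∃ (σ : Ω → M → ℝ) (ρ : M → A → ℝ), CTEq μ₀ uS uR σ ρ := by
  classical
  obtain ⟨m₀⟩ := ‹Nonempty M›
  obtain ⟨a, -, ha⟩ := Finset.exists_max_image Finset.univ
    (fun a : A => ∑ ω, μ₀ ω * uR (a, ω)) Finset.univ_nonempty
  have h1 : IsMsg (fun _ : Ω => dl m₀) := fun _ => isDist_dl _
  have h2 : IsAct (fun _ : M => dl a) := fun _ => isDist_dl _
  refine ⟨fun _ => dl m₀, fun _ => dl a, h1, h2, ?_, ?_⟩
  · rw [SBR_iff hμ h1]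
    intros; exact le_rfl
  · rw [RBR_iff h2]
    intro m c b hc
    obtain rfl := dl_pos hc
    by_cases hm : m = m₀
    · subst hm
      simpa [dl] using ha b (Finset.mem_univ b)
    · simp [dl, hm]

lemma compact_ct (μ₀ : Ω → ℝ) (uS uR : A × Ω → ℝ) :
    IsCompact {p : (Ω → M → ℝ) × (M → A → ℝ) | CTEq μ₀ uS uR p.1 p.2} := by
  have h := (compact_profiles (Ω := Ω) (A := A) (M := M)).inter_right
    ((closed_SBR μ₀ uS).inter (closed_RBR μ₀ uR))
  have he : {p : (Ω → M → ℝ) × (M → A → ℝ) | CTEq μ₀ uS uR p.1 p.2} =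
      {p : (Ω → M → ℝ) × (M → A → ℝ) | IsMsg p.1 ∧ IsAct p.2} ∩
      ({p | SBR μ₀ uS p.1 p.2} ∩ {p | RBR μ₀ uR p.1 p.2}) := by
    ext p
    exact (and_assoc (a := IsMsg p.1) (b := IsAct p.2)
      (c := SBR μ₀ uS p.1 p.2 ∧ RBR μ₀ uR p.1 p.2)).symm
  rw [he]
  exact h

lemma exists_ct (M : Type) [Fintype M] [Nonempty M] [Nonempty A] {μ₀ : Ω → ℝ}
    (hμ : IsPrior μ₀) (uS uR : A × Ω → ℝ) :
    ∃ (σ : Ω → M → ℝ) (ρ : M → A → ℝ), CTEq μ₀ uS uR σ ρ ∧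
      ctPayoff (M := M) μ₀ uS uR = U μ₀ uS σ ρ := by
  obtain ⟨σ₀, ρ₀, h₀⟩ := babble M hμ uS uR
  have hne : {p : (Ω → M → ℝ) × (M → A → ℝ) | CTEq μ₀ uS uR p.1 p.2}.Nonempty :=
    ⟨(σ₀, ρ₀), h₀⟩
  obtain ⟨p, hp, hmax⟩ := (compact_ct (M := M) μ₀ uS uR).exists_isMaxOn hne
    (continuous_U μ₀ uS).continuousOn
  have hp' : CTEq μ₀ uS uR p.1 p.2 := hp
  rw [isMaxOn_iff] at hmax
  refine ⟨p.1, p.2, hp', ?_⟩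
  unfold ctPayoff
  refine IsGreatest.csSup_eq (And.intro ⟨p.1, p.2, hp', rfl⟩ ?_)
  rintro _ ⟨σ, ρ, h, rfl⟩
  have := hmax (σ, ρ) h
  exact this

lemma le_pers {μ₀ : Ω → ℝ} {uS uR : A × Ω → ℝ} {σ : Ω → M → ℝ} {ρ : M → A → ℝ}
    (h : PersProfile μ₀ uR σ ρ) : U μ₀ uS σ ρ ≤ persPayoff (M := M) μ₀ uS uR := by
  refine le_csSup ?_ ⟨σ, ρ, h, rfl⟩
  refine ((compact_profiles (Ω := Ω) (A := A) (M := M)).image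
    (continuous_U μ₀ uS)).bddAbove.mono ?_
  rintro _ ⟨σ, ρ, h, rfl⟩
  exact ⟨(σ, ρ), ⟨h.1, h.2.1⟩, rfl⟩

lemma direction {uS uR : A × Ω → ℝ} (hsc : ScantIndiff uS uR) {i j : A} (hij : j ≠ i)
    (B : Set A) {y : Ω → ℝ} (hy : y ≠ 0)
    (hS : ∑ ω, y ω * (uS (j, ω) - uS (i, ω)) = 0)
    (hB : ∀ b ∈ B, ∑ ω, y ω * (uR (b, ω) - uR (i, ω)) = 0) :
    ∃ d : Ω → ℝ, (∀ ω, y ω = 0 → d ω = 0) ∧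
      ∑ ω, d ω * (uS (j, ω) - uS (i, ω)) = 1 ∧
      ∀ b ∈ B, ∑ ω, d ω * (uR (b, ω) - uR (i, ω)) = 0 := by
  classical
  let r0 : ({j : A // j ≠ i} ⊕ {j : A // j ≠ i}) ⊕ Ω := Sum.inl (Sum.inl ⟨j, hij⟩)
  let s : Finset (({j : A // j ≠ i} ⊕ {j : A // j ≠ i}) ⊕ Ω) :=
    Finset.univ.filter fun r => match r with
      | Sum.inl (Sum.inl k) => k.1 = j
      | Sum.inl (Sum.inr k) => k.1 ∈ B
      | Sum.inr ω => y ω = 0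
  have hr0 : r0 ∈ s := by simp [s, r0]
  let T := (TMat uS uR i).submatrix (fun r : {x // x ∈ s} => r.1) id
  have hrank : T.rank = min s.card (Fintype.card Ω) := hsc i s
  have hTy : T.mulVec y = 0 := by
    funext r
    obtain ⟨r, hr⟩ := r
    simp only [s, Finset.mem_filter, Finset.mem_univ, true_and] at hr
    rcases r with (k | k) | ω
    · simp only at hr
      simp only [T, Matrix.mulVec, dotProduct, TMat, Matrix.submatrix_apply, Matrix.of_apply, id,
        Pi.zero_apply, hr]
      rw [← hS]
      exact Finset.sum_congr rfl fun ω _ => by ring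
    · simp only at hr
      simp only [T, Matrix.mulVec, dotProduct, TMat, Matrix.submatrix_apply, Matrix.of_apply, id,
        Pi.zero_apply]
      rw [← hB _ hr]
      exact Finset.sum_congr rfl fun ω _ => by ring
    · simp only at hr
      simp [T, Matrix.mulVec, dotProduct, TMat, hr]
  have hlt : T.rank < Fintype.card Ω := by
    have h1 := LinearMap.finrank_range_add_finrank_ker T.mulVecLin
    have h2 : 0 < Module.finrank ℝ (LinearMap.ker T.mulVecLin) := by
      rw [Module.finrank_pos_iff_exists_ne_zero]
      exact ⟨⟨y, by simpa using hTy⟩, fun h => hy (congrArg Subtype.val h)⟩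
    rw [Module.finrank_fintype_fun_eq_card] at h1
    unfold Matrix.rank
    omega
  have hcard : T.rank = s.card := by omega
  have hsurj : Function.Surjective T.mulVecLin := by
    rw [← LinearMap.range_eq_top]
    apply Submodule.eq_top_of_finrank_eq
    rw [Module.finrank_fintype_fun_eq_card, Fintype.card_coe, ← hcard, Matrix.rank]
  obtain ⟨d, hd⟩ := hsurj (fun r => if r.1 = r0 then 1 else 0)
  have hd' : ∀ r (hr : r ∈ s), ∑ ω, TMat uS uR i r ω * d ω = if r = r0 then 1 else 0 :=
    fun r hr => congrFun hd ⟨r, hr⟩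
  refine ⟨d, fun ω hω => ?_, ?_, fun b hb => ?_⟩
  · have := hd' (Sum.inr ω) (by simp [s, hω])
    simpa [TMat, r0] using this
  · have := hd' r0 hr0
    simp only [TMat, r0, Matrix.of_apply, if_true] at this
    rw [← this]
    exact Finset.sum_congr rfl fun ω _ => by ring
  · by_cases hbi : b = i
    · simp [hbi]
    · have := hd' (Sum.inl (Sum.inr ⟨b, hbi⟩)) (by simp [s, hb])
      simp only [TMat, r0, Matrix.of_apply] at this
      rw [if_neg (by simp)] at this
      rw [← this]
      exact Finset.sum_congr rfl fun ω _ => by ring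

lemma uS_ne {uS uR : A × Ω → ℝ} (hsc : ScantIndiff uS uR) {i j : A} (hij : j ≠ i) (ω : Ω) :
    uS (j, ω) ≠ uS (i, ω) := by
  classical
  intro h
  obtain ⟨d, h1, h2, -⟩ := direction hsc hij ∅ (y := dl ω)
    (fun h => by simpa [dl] using congrFun h ω) (by rw [sum_dl, h, sub_self]) (by simp)
  rw [Finset.sum_eq_zero] at h2
  · norm_num at h2
  · intro ω' _
    by_cases hw : ω' = ω
    · subst hw; rw [h, sub_self, mul_zero]
    · rw [h1 ω' (by simp [dl, hw]), zero_mul]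

lemma small {I : Type} [Finite I] (c e : I → ℝ) (hc : ∀ i, 0 ≤ c i)
    (he : ∀ i, c i = 0 → e i = 0) : ∃ ε > 0, ∀ i, 0 ≤ c i + ε * e i := by
  have h : ∀ i, ∀ᶠ ε in nhdsWithin (0 : ℝ) (Set.Ioi 0), 0 ≤ c i + ε * e i := by
    intro i
    rcases (hc i).eq_or_lt with h0 | h0
    · simp [← h0, he i h0.symm]
    · have : Filter.Tendsto (fun ε : ℝ => c i + ε * e i) (nhds 0) (nhds (c i + 0 * e i)) :=
        Continuous.tendsto (by fun_prop) 0
      rw [zero_mul, add_zero] at this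
      exact ((this.eventually (lt_mem_nhds h0)).filter_mono nhdsWithin_le_nhds).mono
        fun _ h => h.le
  obtain ⟨ε, h1, h2⟩ := ((Filter.eventually_all.2 h).and self_mem_nhdsWithin).exists
  exact ⟨ε, h2, h1⟩

open Classical in
/-- Moving mass `z` from action `i` to action `j`. -/
noncomputable def shift (x : A → Ω → ℝ) (i j : A) (z : Ω → ℝ) (a : A) (ω : Ω) : ℝ :=
  x a ω + (if a = j then z ω else 0) - (if a = i then z ω else 0)

lemma val_shift (u : A × Ω → ℝ) (x : A → Ω → ℝ) (i j : A) (z : Ω → ℝ) :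
    Val u (shift x i j z) = Val u x + ∑ ω, z ω * (u (j, ω) - u (i, ω)) := by
  classical
  unfold Val shift
  simp only [add_mul, sub_mul, ite_mul, zero_mul, Finset.sum_add_distrib, Finset.sum_sub_distrib,
    mul_sub]
  rw [Finset.sum_comm (f := fun a ω => if a = j then z ω * u (a, ω) else 0),
    Finset.sum_comm (f := fun a ω => if a = i then z ω * u (a, ω) else 0)]
  simp only [Finset.sum_ite_eq', Finset.mem_univ, if_true]
  ring

lemma feas_shift {μ₀ : Ω → ℝ} {uR : A × Ω → ℝ} {x : A → Ω → ℝ} (hx : Feas μ₀ uR x)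
    {i j : A} (hij : j ≠ i) {z : Ω → ℝ}
    (h1 : ∀ ω, 0 ≤ x j ω + z ω) (h2 : ∀ ω, 0 ≤ x i ω - z ω)
    (h3 : ∀ b, 0 ≤ ∑ ω, x j ω * (uR (j, ω) - uR (b, ω)) + ∑ ω, z ω * (uR (j, ω) - uR (b, ω)))
    (h4 : ∀ b, 0 ≤ ∑ ω, x i ω * (uR (i, ω) - uR (b, ω)) - ∑ ω, z ω * (uR (i, ω) - uR (b, ω))) :
    Feas μ₀ uR (shift x i j z) := by
  classical
  have ej : shift x i j z j = fun ω => x j ω + z ω := by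
    funext ω; simp [shift, hij]
  have ei : shift x i j z i = fun ω => x i ω - z ω := by
    funext ω; simp [shift, hij.symm]
  have eo : ∀ a, a ≠ i → a ≠ j → shift x i j z a = x a := by
    intro a h h'; funext ω; simp [shift, h, h']
  refine ⟨fun a ω => ?_, fun ω => ?_, fun a b => ?_⟩
  · by_cases hi : a = i
    · subst hi; rw [ei]; exact h2 ω
    · by_cases hj : a = j
      · subst hj; rw [ej]; exact h1 ω
      · rw [eo a hi hj]; exact hx.1 a ω
  · simp [shift, Finset.sum_add_distrib, Finset.sum_sub_distrib, hx.2.1]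
  · by_cases hi : a = i
    · subst hi; rw [ei]; simp only [sub_mul, Finset.sum_sub_distrib (G := ℝ)] at *
      simpa [mul_sub, sub_mul, Finset.sum_sub_distrib] using h4 b
    · by_cases hj : a = j
      · subst hj; rw [ej]
        simp only [add_mul, Finset.sum_add_distrib]
        exact h3 b
      · rw [eo a hi hj]; exact hx.2.2 a b

/-- On-path purity. -/
lemma pure_on_path {μ₀ : Ω → ℝ} (hμ : IsPrior μ₀) {uS uR : A × Ω → ℝ}
    (hsc : ScantIndiff uS uR) {σ : Ω → M → ℝ} {ρ : M → A → ℝ} (h : PersProfile μ₀ uR σ ρ)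
    (hopt : ∀ x, Feas μ₀ uR x → Val uS x ≤ Val uS (outc μ₀ σ ρ))
    {m : M} (hm : OnPath σ m) {i j : A} (hi : 0 < ρ m i) (hj : 0 < ρ m j) : j = i := by
  classical
  by_contra hij
  have hF := feas_outc hμ h
  obtain ⟨hσ, hρ, hR⟩ := h
  rw [RBR_iff hρ] at hR
  set x := outc μ₀ σ ρ with hxdef
  set y : Ω → ℝ := fun ω => μ₀ ω * σ ω m with hydef
  have hy0 : ∀ ω, 0 ≤ y ω := fun ω => mul_nonneg (hμ.1 ω).le ((hσ ω).1 m)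
  have hyne : y ≠ 0 := by
    obtain ⟨ω, hω⟩ := hm
    intro h0
    have := congrFun h0 ω
    exact (mul_pos (hμ.1 ω) hω).ne' this
  -- the contribution of message m
  have hxy : ∀ a ω, ρ m a * y ω ≤ x a ω := by
    intro a ω
    have := Finset.single_le_sum (f := fun m => μ₀ ω * σ ω m * ρ m a)
      (fun k _ => mul_nonneg (mul_nonneg (hμ.1 ω).le ((hσ ω).1 k)) ((hρ k).1 a))
      (Finset.mem_univ m)
    calc ρ m a * y ω = μ₀ ω * σ ω m * ρ m a := by rw [hydef]; ring
      _ ≤ _ := this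
  have hms : ∀ k a b, ∑ ω, μ₀ ω * σ ω k * ρ k a * (uR (a, ω) - uR (b, ω)) =
        ρ k a * (∑ ω, μ₀ ω * σ ω k * uR (a, ω) - ∑ ω, μ₀ ω * σ ω k * uR (b, ω)) := by
    intro k a b
    rw [← Finset.sum_sub_distrib, Finset.mul_sum]
    exact Finset.sum_congr rfl fun ω _ => by ring
  have hxyR : ∀ a b, ρ m a * ∑ ω, y ω * (uR (a, ω) - uR (b, ω)) ≤
      ∑ ω, x a ω * (uR (a, ω) - uR (b, ω)) := by
    intro a b
    have h1 : ∑ ω, x a ω * (uR (a, ω) - uR (b, ω)) =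
        ∑ k, ∑ ω, μ₀ ω * σ ω k * ρ k a * (uR (a, ω) - uR (b, ω)) := by
      simp only [hxdef, outc, Finset.sum_mul]
      rw [Finset.sum_comm]
    rw [h1]
    have := Finset.single_le_sum
      (f := fun k => ∑ ω, μ₀ ω * σ ω k * ρ k a * (uR (a, ω) - uR (b, ω)))
      (fun k _ => by
        rw [hms]
        rcases ((hρ k).1 a).eq_or_lt with h0 | h0
        · simp [← h0]
        · exact mul_nonneg h0.le (sub_nonneg.2 (hR k a b h0)))
      (Finset.mem_univ m)
    refine le_trans (le_of_eq ?_) this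
    rw [Finset.mul_sum]
    exact Finset.sum_congr rfl fun ω _ => by rw [hydef]; ring
  have hyR : ∀ a b, 0 < ρ m a → 0 ≤ ∑ ω, y ω * (uR (a, ω) - uR (b, ω)) := by
    intro a b ha
    have := hR m a b ha
    simp only [mul_sub, Finset.sum_sub_distrib]
    linarith
  have hsplit : ∀ (z : Ω → ℝ) (u : A × Ω → ℝ) (a b c : A), ∑ ω, z ω * (u (a, ω) - u (b, ω)) =
      ∑ ω, z ω * (u (c, ω) - u (b, ω)) - ∑ ω, z ω * (u (c, ω) - u (a, ω)) := by
    intro z u a b c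
    rw [← Finset.sum_sub_distrib]
    exact Finset.sum_congr rfl fun ω _ => by ring
  have hneg : ∀ (z : Ω → ℝ) (u : A × Ω → ℝ) (a b : A), ∑ ω, z ω * (u (a, ω) - u (b, ω)) =
      - ∑ ω, z ω * (u (b, ω) - u (a, ω)) := by
    intro z u a b
    rw [← Finset.sum_neg_distrib]
    exact Finset.sum_congr rfl fun ω _ => by ring
  have hyij : ∑ ω, y ω * (uR (i, ω) - uR (j, ω)) = 0 := by
    have h1 := hyR i j hi
    have h2 := hyR j i hj
    rw [hneg] at h2
    linarith
  -- general improvement tool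
  have key : ∀ (a b : A), b ≠ a → 0 < ρ m a → 0 < ρ m b → ∀ d : Ω → ℝ,
      (∀ ω, y ω = 0 → d ω = 0) →
      (∀ c, ∑ ω, y ω * (uR (a, ω) - uR (c, ω)) = 0 → ∑ ω, d ω * (uR (a, ω) - uR (c, ω)) = 0) →
      (∀ c, ∑ ω, y ω * (uR (b, ω) - uR (c, ω)) = 0 → ∑ ω, d ω * (uR (b, ω) - uR (c, ω)) = 0) →
      ∑ ω, d ω * (uS (b, ω) - uS (a, ω)) ≤ 0 := by
    intro a b hab ha hb d hd0 hda hdb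
    have hx0 : ∀ c, 0 < ρ m c → ∀ ω, x c ω = 0 → d ω = 0 := by
      intro c hc ω h0
      apply hd0
      have h1 := hxy c ω
      rw [h0] at h1
      have h2 := hy0 ω
      nlinarith
    have hR0 : ∀ c, 0 < ρ m c → ∀ e, ∑ ω, x c ω * (uR (c, ω) - uR (e, ω)) = 0 →
        ∑ ω, y ω * (uR (c, ω) - uR (e, ω)) = 0 := by
      intro c hc e h0
      have h1 := hxyR c e
      rw [h0] at h1
      have h2 := hyR c e hc
      nlinarith
    obtain ⟨ε, hε, hall⟩ := small (I := (Ω ⊕ Ω) ⊕ (A ⊕ A))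
      (Sum.elim (Sum.elim (x b) (x a))
        (Sum.elim (fun c => ∑ ω, x b ω * (uR (b, ω) - uR (c, ω)))
          (fun c => ∑ ω, x a ω * (uR (a, ω) - uR (c, ω)))))
      (Sum.elim (Sum.elim d (fun ω => - d ω))
        (Sum.elim (fun c => ∑ ω, d ω * (uR (b, ω) - uR (c, ω)))
          (fun c => - ∑ ω, d ω * (uR (a, ω) - uR (c, ω)))))
      (by
        rintro ((ω | ω) | (c | c))
        · exact hF.1 b ω
        · exact hF.1 a ω
        · exact hF.2.2 b c
        · exact hF.2.2 a c)
      (by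
        rintro ((ω | ω) | (c | c)) h0
        · exact hx0 b hb ω h0
        · exact neg_eq_zero.2 (hx0 a ha ω h0)
        · exact hdb c (hR0 b hb c h0)
        · exact neg_eq_zero.2 (hda c (hR0 a ha c h0)))
    have hfe : Feas μ₀ uR (shift x a b (fun ω => ε * d ω)) := by
      have hpull : ∀ c e : A, ∑ ω, ε * d ω * (uR (c, ω) - uR (e, ω)) =
          ε * ∑ ω, d ω * (uR (c, ω) - uR (e, ω)) := by
        intro c e
        rw [Finset.mul_sum]
        exact Finset.sum_congr rfl fun ω _ => by ring
      refine feas_shift hF hab ?_ ?_ ?_ ?_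
      · intro ω; exact hall (Sum.inl (Sum.inl ω))
      · intro ω
        have := hall (Sum.inl (Sum.inr ω))
        simp only [Sum.elim_inl, Sum.elim_inr] at this
        linarith
      · intro c
        have := hall (Sum.inr (Sum.inl c))
        simp only [Sum.elim_inl, Sum.elim_inr] at this
        rw [hpull]; exact this
      · intro c
        have := hall (Sum.inr (Sum.inr c))
        simp only [Sum.elim_inr] at this
        rw [hpull]; linarith
    have h1 := hopt _ hfe
    rw [val_shift] at h1
    have h2 : ∑ ω, ε * d ω * (uS (b, ω) - uS (a, ω)) =
        ε * ∑ ω, d ω * (uS (b, ω) - uS (a, ω)) := by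
      rw [Finset.mul_sum]
      exact Finset.sum_congr rfl fun ω _ => by ring
    rw [h2] at h1
    by_contra hpos
    push Not at hpos
    have := mul_pos hε hpos
    linarith
  have hS : ∑ ω, y ω * (uS (j, ω) - uS (i, ω)) = 0 := by
    have h1 := key i j hij hi hj y (fun _ h => h) (fun _ h => h) (fun _ h => h)
    have h2 := key j i (Ne.symm hij) hj hi y (fun _ h => h) (fun _ h => h) (fun _ h => h)
    rw [hneg] at h2
    linarith
  obtain ⟨d, hd0, hd1, hdB⟩ := direction hsc hij
    {b | ∑ ω, y ω * (uR (b, ω) - uR (i, ω)) = 0} hyne hS (fun b hb => hb)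
  have hdi : ∀ c, ∑ ω, y ω * (uR (i, ω) - uR (c, ω)) = 0 →
      ∑ ω, d ω * (uR (i, ω) - uR (c, ω)) = 0 := by
    intro c hc
    rw [hneg, neg_eq_zero] at hc ⊢
    exact hdB c hc
  have := key i j hij hi hj d hd0 hdi (by
    intro c hc
    rw [hsplit _ _ j c i] at hc ⊢
    rw [hyij, sub_zero] at hc
    rw [hdi c hc, hdi j hyij, sub_zero])
  linarith

/-- Key Proposition (Kamenica–Lin): in a scant-indifferences environment, if
commitment has no value then some partitional, pure cheap-talk equilibrium with at
most `|A|` on-path messages attains the persuasion payoff. -/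
theorem key_proposition
    (Ω A M : Type) [Fintype Ω] [Fintype A] [Fintype M]
    [Nonempty Ω] [Nonempty A]
    (hM : max (Fintype.card Ω) (Fintype.card A) < Fintype.card M)
    (μ₀ : Ω → ℝ) (hμ : IsPrior μ₀)
    (uS uR : A × Ω → ℝ)
    (huS : ∀ p, uS p ∈ Set.Icc (0 : ℝ) 1) (huR : ∀ p, uR p ∈ Set.Icc (0 : ℝ) 1)
    (hscant : ScantIndiff uS uR)
    (hnoval : ¬ (ctPayoff (M := M) μ₀ uS uR < persPayoff (M := M) μ₀ uS uR)) :
    ∃ (σ : Ω → M → ℝ) (ρ : M → A → ℝ),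
      Partitional σ ∧ IsPureAct ρ ∧ CTEq μ₀ uS uR σ ρ ∧
      U μ₀ uS σ ρ = persPayoff (M := M) μ₀ uS uR ∧
      Set.ncard {m : M | OnPath σ m} ≤ Fintype.card A := by
  classical
  have hcA : Fintype.card A ≤ Fintype.card M := by
    have := le_max_right (Fintype.card Ω) (Fintype.card A)
    omega
  have hMne : Nonempty M := Fintype.card_pos_iff.1 (by omega)
  obtain ⟨ι⟩ := Function.Embedding.nonempty_of_card_le hcA
  have hι : Function.Injective ι := ι.injective
  obtain ⟨σ, ρ, hct, hval⟩ := exists_ct (Ω := Ω) M hμ uS uR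
  obtain ⟨hσ, hρ, hS, hR⟩ := hct
  have hP : PersProfile μ₀ uR σ ρ := ⟨hσ, hρ, hR⟩
  have hV : U μ₀ uS σ ρ = persPayoff (M := M) μ₀ uS uR :=
    le_antisymm (le_pers hP) (by rw [← hval]; exact not_lt.1 hnoval)
  have hopt : ∀ x, Feas μ₀ uR x → Val uS x ≤ Val uS (outc μ₀ σ ρ) := by
    intro x hx
    obtain ⟨h1, h2⟩ := realize hμ hx hι (g := Function.invFun ι)
      (fun a _ _ => Function.leftInverse_invFun hι a)
    have h3 := le_pers (uS := uS) h1
    rw [U_eqX, h2, ← hV, U_eqX] at h3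
    exact h3
  have hpure : ∀ m, OnPath σ m → ∃ a, ρ m = dl a := by
    intro m hm
    have hex : ∃ a, 0 < ρ m a := by
      by_contra hne
      push Not at hne
      have := Finset.sum_nonpos (s := Finset.univ) (fun x _ => hne x)
      rw [(hρ m).2] at this
      linarith
    obtain ⟨a, ha⟩ := hex
    have hz : ∀ b, b ≠ a → ρ m b = 0 := by
      intro b hb
      by_contra h0
      exact hb (pure_on_path hμ hscant hP hopt hm ha (lt_of_le_of_ne ((hρ m).1 b) (Ne.symm h0)))
    have h1 : ρ m a = 1 := by
      rw [← (hρ m).2, Finset.sum_eq_single a (fun b _ hb => hz b hb) (by simp)]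
    refine ⟨a, funext fun b => ?_⟩
    by_cases hb : b = a
    · subst hb; simp [dl, h1]
    · simp [dl, hb, hz b hb]
  have hsent : ∀ ω, ∃ m, 0 < σ ω m := by
    intro ω
    by_contra hne
    push Not at hne
    have := Finset.sum_nonpos (s := Finset.univ) (fun x _ => hne x)
    rw [(hσ ω).2] at this
    linarith
  choose μm hμm using hsent
  choose α hα using fun ω => hpure (μm ω) ⟨ω, hμm ω⟩
  rw [SBR_iff hμ hσ] at hS
  -- every message sent at ω leads to α ω
  have hall : ∀ ω m, 0 < σ ω m → ρ m = dl (α ω) := by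
    intro ω m hm
    obtain ⟨a, ha⟩ := hpure m ⟨ω, hm⟩
    rw [ha]
    by_contra hne
    have hne' : a ≠ α ω := fun h => hne (by rw [h])
    have h1 := hS ω m (μm ω) hm
    have h2 := hS ω (μm ω) m (hμm ω)
    rw [ha, hα ω, sum_dl, sum_dl] at h1 h2
    exact uS_ne hscant hne' ω (le_antisymm h2 h1)
  have hbest : ∀ ω ω', uS (α ω', ω) ≤ uS (α ω, ω) := by
    intro ω ω'
    have h1 := hS ω (μm ω) (μm ω') (hμm ω)
    rwa [hα ω, hα ω', sum_dl, sum_dl] at h1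
  set x := outc μ₀ σ ρ with hx
  have hxe : ∀ a ω, x a ω = if a = α ω then μ₀ ω else 0 := by
    intro a ω
    have h1 : ∀ m, μ₀ ω * σ ω m * ρ m a = σ ω m * (μ₀ ω * dl (α ω) a) := by
      intro m
      rcases ((hσ ω).1 m).eq_or_lt with h0 | h0
      · simp [← h0]
      · rw [hall ω m h0]; ring
    simp only [hx, outc, h1]
    rw [← Finset.sum_mul, (hσ ω).2]
    simp [dl]
  obtain ⟨ω₀⟩ := ‹Nonempty Ω›
  let g : M → A := fun m => if h : ∃ ω, ι (α ω) = m then α h.choose else α ω₀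
  have hgr : ∀ m, ∃ ω, g m = α ω := by
    intro m
    simp only [g]
    split_ifs with h
    · exact ⟨_, rfl⟩
    · exact ⟨_, rfl⟩
  have hgα : ∀ ω, g (ι (α ω)) = α ω := by
    intro ω
    have h : ∃ ω', ι (α ω') = ι (α ω) := ⟨ω, rfl⟩
    simp only [g, dif_pos h]
    exact hι h.choose_spec
  obtain ⟨hP', hout⟩ := realize hμ (feas_outc hμ hP) hι (g := g) (by
    intro a ω h
    rw [← hx, hxe] at h
    have : a = α ω := by
      by_contra hne
      simp [hne] at h
    rw [this, hgα])
  rw [← hx] at hP' hout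
  have hsg : ∀ ω m, sig μ₀ x ι ω m = if m = ι (α ω) then 1 else 0 := by
    intro ω m
    by_cases hm : ∃ c, ι c = m
    · obtain ⟨c, rfl⟩ := hm
      rw [sig_ι hι, hxe]
      by_cases hc : c = α ω
      · simp [hc, (hμ.1 ω).ne']
      · simp [hc]
    · push Not at hm
      rw [sig_not _ _ hm, if_neg (fun h => hm _ h.symm)]
  refine ⟨sig μ₀ x ι, fun m => dl (g m), ?_, ?_, ⟨hP'.1, hP'.2.1, ?_, hP'.2.2⟩, ?_, ?_⟩
  · intro ω
    exact ⟨ι (α ω), by rw [hsg, if_pos rfl]⟩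
  · intro m
    exact ⟨g m, by simp [dl]⟩
  · rw [SBR_iff hμ hP'.1]
    intro ω m m' hm
    have hm' : m = ι (α ω) := by
      by_contra hne
      rw [hsg, if_neg hne] at hm
      exact lt_irrefl _ hm
    rw [sum_dl, sum_dl, hm', hgα]
    obtain ⟨ω', h⟩ := hgr m'
    rw [h]
    exact hbest ω ω'
  · rw [U_eqX, hout, hx, ← U_eqX, hV]
  · have hsub : {m : M | OnPath (sig μ₀ x ι) m} ⊆ Set.range ι := by
      rintro m ⟨ω, hm⟩
      by_contra hne
      rw [hsg, if_neg (fun h => hne ⟨_, h.symm⟩)] at hm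
      exact lt_irrefl _ hm
    calc Set.ncard {m : M | OnPath (sig μ₀ x ι) m} ≤ (Set.range ι).ncard :=
          Set.ncard_le_ncard hsub (Set.toFinite _)
      _ = Fintype.card A := by
          rw [← Set.image_univ, Set.ncard_image_of_injective _ hι, Set.ncard_univ,
            Nat.card_eq_fintype_card]

end KL
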